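/- For every γ ∈ ℝ, the power divergence generator φ_γ satisfies condition (1): there exists 0 < η < 1 such that for all c ∈ [1−η, 1+η] one can find constants c₁, c₂, c₃ with φ_γ(cx) ≤ c₁ φ_γ(x) + c₂ |x| + c₃ for all x ∈ (0, ∞). -/

import Mathlib

noncomputable section

/-- The power divergence generators `φ_γ` of Cressie and Read. -/
def powerPhi (γ : ℝ) (x : ℝ) : ℝ :=
  if γ = 0 then -Real.log x + x - 1
  else if γ = 1 then x * Real.log x - x + 1
  else (x ^ γ - γ * x + γ - 1) / (γ * (γ - 1))

/-- Every power divergence generator `φ_γ` satisfies the growth condition (EqRem1):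
there is `0 < η < 1` such that for all `c ∈ [1−η, 1+η]` there are constants
`c₁, c₂, c₃` with `φ_γ(cx) ≤ c₁ φ_γ(x) + c₂ |x| + c₃` for all `x ∈ (0,∞)`. -/
theorem powerPhi_satisfies_growth_condition (γ : ℝ) :
    ∃ η : ℝ, 0 < η ∧ η < 1 ∧ ∀ c ∈ Set.Icc (1 - η) (1 + η),
      ∃ c₁ c₂ c₃ : ℝ, ∀ x ∈ Set.Ioi (0 : ℝ),
        powerPhi γ (c * x) ≤ c₁ * powerPhi γ x + c₂ * |x| + c₃ := by
  refine ⟨1 / 2, by norm_num, by norm_num, fun c hc => ?_⟩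
  have hc0 : 0 < c := by linarith [hc.1]
  by_cases h0 : γ = 0
  · refine ⟨1, c - 1, -Real.log c, fun x hx => le_of_eq ?_⟩
    have hx : 0 < x := hx
    simp only [powerPhi, if_pos h0]
    rw [abs_of_pos hx, Real.log_mul hc0.ne' hx.ne']
    ring
  by_cases h1 : γ = 1
  · refine ⟨c, c * Real.log c, 1 - c, fun x hx => le_of_eq ?_⟩
    have hx : 0 < x := hx
    simp only [powerPhi, if_neg h0, if_pos h1]
    rw [abs_of_pos hx, Real.log_mul hc0.ne' hx.ne']
    ring
  · refine ⟨c ^ γ, (c ^ γ * γ - γ * c) / (γ * (γ - 1)),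
      (1 - c ^ γ) * (γ - 1) / (γ * (γ - 1)), fun x hx => le_of_eq ?_⟩
    have hx : 0 < x := hx
    simp only [powerPhi, if_neg h0, if_neg h1]
    rw [abs_of_pos hx, Real.mul_rpow hc0.le hx.le]
    ring
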